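/- arXiv:math/0703122 — 2 statements merged into one kernel-verified Lean document; each statement's English description precedes it below -/
import Mathlib

section
/- Let K be a field of characteristic p > 0, X a normal K-scheme of finite type that is geometrically integral, and K ⊆ K' a field extension. If Y' → X ⊗_K K' is the normalization of X' = X ⊗_K K', then Y' is a geometrically integral K'-scheme. -/
open AlgebraicGeometry CategoryTheory CategoryTheory.Limits

noncomputable section

universe u

/-- `Spec` of a field (or ring). -/
abbrev SpecOf (K : Type u) [CommRing K] : Scheme.{u} := Spec (CommRingCat.of K)

/-- The morphism of spectra induced by a ring extension. -/
def specMapAlg (K L : Type u) [CommRing K] [CommRing L] [Algebra K L] :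
    SpecOf L ⟶ SpecOf K := Spec.map (CommRingCat.ofHom (algebraMap K L))

/-- Base change `X ⊗_K L` of a `K`-scheme along a field extension `K ⊆ L`. -/
def baseChange {K : Type u} [CommRing K] {X : Scheme.{u}} (f : X ⟶ SpecOf K)
    (L : Type u) [CommRing L] [Algebra K L] : Scheme.{u} :=
  pullback f (specMapAlg K L)

/-- Structure morphism of the base change `X ⊗_K L` over `L`. -/
def baseChangeStruct {K : Type u} [CommRing K] {X : Scheme.{u}} (f : X ⟶ SpecOf K)
    (L : Type u) [CommRing L] [Algebra K L] : baseChange f L ⟶ SpecOf L :=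
  pullback.snd f (specMapAlg K L)

/-- A `K`-scheme is geometrically integral if all its base changes to field
extensions are integral. -/
def IsGeometricallyIntegral {K : Type u} [Field K] {X : Scheme.{u}}
    (f : X ⟶ SpecOf K) : Prop :=
  ∀ (L : Type u) [Field L] [Algebra K L], IsIntegral (baseChange f L)

/-- A scheme is normal if it is integral with integrally closed stalks. -/
def IsNormalScheme (X : Scheme.{u}) : Prop :=
  IsIntegral X ∧ ∀ x : X, IsIntegrallyClosed (X.presheaf.stalk x)

/-- A `K`-scheme is geometrically normal if all its base changes to field
extensions are normal. -/
def IsGeometricallyNormal {K : Type u} [Field K] {X : Scheme.{u}}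
    (f : X ⟶ SpecOf K) : Prop :=
  ∀ (L : Type u) [Field L] [Algebra K L], IsNormalScheme (baseChange f L)

/-- `ν : Y ⟶ X` is the normalization of the integral scheme `X`:  `Y` is normal,
`ν` is integral and dominant, and every dominant morphism from a normal scheme
factors uniquely through `ν`. -/
def IsNormalization {Y X : Scheme.{u}} (ν : Y ⟶ X) : Prop :=
  IsNormalScheme Y ∧ IsIntegralHom ν ∧ IsDominant ν ∧
    ∀ (Z : Scheme.{u}) (g : Z ⟶ X), IsNormalScheme Z → IsDominant g →
      ∃! h : Z ⟶ Y, h ≫ ν = g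

/-- The absolute Frobenius of `Spec K`. -/
def frobSpec (K : Type u) [Field K] (p : ℕ) [Fact p.Prime] [CharP K p] :
    SpecOf K ⟶ SpecOf K := Spec.map (CommRingCat.ofHom (frobenius K p))

/-- The `n`-fold iterated Frobenius of `Spec K`. -/
def iterFrobSpec (K : Type u) [Field K] (p : ℕ) [Fact p.Prime] [CharP K p] (n : ℕ) :
    SpecOf K ⟶ SpecOf K := Spec.map (CommRingCat.ofHom (iterateFrobenius K p n))

/-- The Frobenius pullback `X^{(p)}`. -/
def frobPullback {K : Type u} [Field K] {X : Scheme.{u}} (f : X ⟶ SpecOf K)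
    (p : ℕ) [Fact p.Prime] [CharP K p] : Scheme.{u} := pullback f (frobSpec K p)

/-- The iterated Frobenius pullback `X^{(pⁿ)}`. -/
def iterFrobPullback {K : Type u} [Field K] {X : Scheme.{u}} (f : X ⟶ SpecOf K)
    (p : ℕ) [Fact p.Prime] [CharP K p] (n : ℕ) : Scheme.{u} :=
  pullback f (iterFrobSpec K p n)

/-- Universal homeomorphisms of schemes. -/
def UniversalHomeomorphism : MorphismProperty Scheme.{u} :=
  MorphismProperty.universally (AlgebraicGeometry.topologically @IsHomeomorph)

end

open TensorProduct in
/-- If `A ⊗[k] L` is a domain, then so is `F ⊗[k] L` for `F` the fraction field of `A`. -/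
lemma isDomain_fractionRing_tensorProduct (k A F L : Type*) [Field k] [CommRing A]
    [IsDomain A] [Field F] [Field L] [Algebra k A] [Algebra k F] [Algebra A F]
    [IsScalarTower k A F] [IsFractionRing A F] [Algebra k L] [IsDomain (A ⊗[k] L)] :
    IsDomain (F ⊗[k] L) := by
  let φ : A ⊗[k] L →ₐ[A] F ⊗[k] L := Algebra.TensorProduct.map (Algebra.ofId A F) (.id k L)
  let : Algebra (A ⊗[k] L) (F ⊗[k] L) := φ.toRingHom.toAlgebra
  have : IsScalarTower A (A ⊗[k] L) (F ⊗[k] L) := .of_algebraMap_eq' φ.comp_algebraMap.symm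
  have := IsLocalization.tensorProduct_tensorProduct k L (nonZeroDivisors A) F
    (by ext x; simp [RingHom.algebraMap_toAlgebra, φ])
  refine IsLocalization.isDomain_of_le_nonZeroDivisors (F ⊗[k] L)
    (M := Algebra.algebraMapSubmonoid (A ⊗[k] L) (nonZeroDivisors A)) ?_
  rintro _ ⟨a, ha, rfl⟩
  rw [SetLike.mem_coe, mem_nonZeroDivisors_iff_ne_zero] at ha
  rw [mem_nonZeroDivisors_iff_ne_zero]
  have : Function.Injective (algebraMap A (A ⊗[k] L)) :=
    Algebra.TensorProduct.includeLeft_injective (R := k) (S := k) (A := A) (B := L)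
      (algebraMap k L).injective
  exact fun h ↦ ha (this (h.trans (map_zero _).symm))

lemma isIntegral_of_isSchemeTheoreticallyDominant {X Y : Scheme.{u}} (f : X ⟶ Y) [IsIntegral X]
    [QuasiCompact f] [IsSchemeTheoreticallyDominant f] : IsIntegral Y := by
  rw [isIntegral_iff_irreducibleSpace_and_isReduced]
  refine ⟨?_, IsSchemeTheoreticallyDominant.isReduced f⟩
  have h := f.denseRange.closure_range
  have : IsIrreducible (Set.univ : Set Y) := by
    rw [← h, isIrreducible_iff_closure, ← Set.image_univ]
    exact (IrreducibleSpace.isIrreducible_univ X).image _ f.continuous.continuousOn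
  exact (irreducibleSpace_def _).mpr this

lemma isDominant_specMap_of_injective {R S : CommRingCat.{u}} (φ : R ⟶ S)
    (hφ : Function.Injective φ.hom) : IsDominant (Spec.map φ) := by
  refine ⟨(PrimeSpectrum.denseRange_comap_iff_ker_le_nilRadical φ.hom).mpr ?_⟩
  rw [(RingHom.injective_iff_ker_eq_bot _).mp hφ]
  exact bot_le

/-- A lift of the generic point of `Spec A` along an integral morphism from an integral scheme
is dominant. -/
lemma isDominant_of_comp_isIntegralHom {A F : Type u} [CommRing A] [IsDomain A] [Field F]
    [Algebra A F] [FaithfulSMul A F] {T : Scheme.{u}} [IsIntegral T]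
    (q : T ⟶ SpecOf A) [IsIntegralHom q] (k : SpecOf F ⟶ T) (h : k ≫ q = specMapAlg A F) :
    IsDominant k := by
  have : IsAffine T := isAffine_of_isAffineHom q
  let e := T.isoSpec
  obtain ⟨α, hα⟩ := Spec.map_surjective (e.inv ≫ q)
  obtain ⟨β, hβ⟩ := Spec.map_surjective (k ≫ e.hom)
  have hint : α.hom.IsIntegral := by
    rw [← IsIntegralHom.SpecMap_iff, hα]
    infer_instance
  have hcomp : α ≫ β = CommRingCat.ofHom (algebraMap A F) := by
    apply Spec.map_injective
    rw [Spec.map_comp, hα, hβ]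
    simpa [specMapAlg] using h
  have hinj : Function.Injective β.hom := by
    rw [RingHom.injective_iff_ker_eq_bot]
    let := α.hom.toAlgebra
    have : Algebra.IsIntegral A Γ(T, ⊤) := ⟨hint⟩
    refine Ideal.eq_bot_of_comap_eq_bot (R := A) ?_
    rw [RingHom.ker_eq_comap_bot, Ideal.comap_comap, ← RingHom.ker_eq_comap_bot,
      ← RingHom.injective_iff_ker_eq_bot]
    have : β.hom.comp (algebraMap A Γ(T, ⊤)) = algebraMap A F :=
      congrArg CommRingCat.Hom.hom hcomp
    rw [this]
    exact FaithfulSMul.algebraMap_injective A F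
  have : IsDominant (k ≫ e.hom) := hβ ▸ isDominant_specMap_of_injective β hinj
  rw [show k = (k ≫ e.hom) ≫ e.inv by simp]
  infer_instance

lemma isNormalScheme_spec_field (F : Type u) [Field F] : IsNormalScheme (SpecOf F) := by
  have : IsDomain (CommRingCat.of F) := inferInstanceAs (IsDomain F)
  refine ⟨inferInstance, fun x ↦ ?_⟩
  rw [Subsingleton.elim x (genericPoint (SpecOf F))]
  exact inferInstanceAs (IsIntegrallyClosed (SpecOf F).functionField)

lemma isDominant_of_isOpenImmersion {U X : Scheme.{u}} [Nonempty U] [IrreducibleSpace X]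
    (i : U ⟶ X) [IsOpenImmersion i] : IsDominant i :=
  ⟨i.isOpenEmbedding.isOpen_range.dense (Set.range_nonempty _)⟩

lemma isIntegral_of_iso {X Y : Scheme.{u}} (e : X ≅ Y) [IsIntegral Y] : IsIntegral X :=
  have : Nonempty X := (inferInstance : Nonempty Y).map e.inv
  isIntegral_of_isOpenImmersion e.hom

lemma isGeometricallyIntegral_iff {K : Type u} [Field K] {X : Scheme.{u}} (f : X ⟶ SpecOf K) :
    IsGeometricallyIntegral f ↔ GeometricallyIntegral f := by
  have : ObjectProperty.IsClosedUnderIsomorphisms (IsIntegral : ObjectProperty Scheme.{u}) :=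
    ⟨fun e _ ↦ isIntegral_of_iso e.symm⟩
  rw [geometricallyIntegral_iff, geometrically_iff_of_commRing_of_isClosedUnderIsomorphisms]
  rfl

open TensorProduct in
lemma isIntegral_pullback_fractionRing {K A F L : Type u} [Field K] [CommRing A] [IsDomain A]
    [Field F] [Algebra A F] [IsFractionRing A F] [Field L] [Algebra K L]
    (s : SpecOf A ⟶ SpecOf K) [IsIntegral (pullback s (specMapAlg K L))] :
    IsIntegral (pullback (specMapAlg A F ≫ s) (specMapAlg K L)) := by
  obtain ⟨σ, rfl⟩ := Spec.map_surjective s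
  let : Algebra K A := σ.hom.toAlgebra
  let : Algebra K F := ((algebraMap A F).comp σ.hom).toAlgebra
  have : IsScalarTower K A F := .of_algebraMap_eq' rfl
  have : IsDomain (A ⊗[K] L) := by
    have := isIntegral_of_iso (pullbackSpecIso K A L).symm
      (Y := pullback (Spec.map σ) (specMapAlg K L))
    exact (affine_isIntegral_iff (.of (A ⊗[K] L))).mp this
  have := isDomain_fractionRing_tensorProduct K A F L
  have : IsIntegral (Spec (.of (F ⊗[K] L))) := (affine_isIntegral_iff (.of (F ⊗[K] L))).mpr this
  have h : specMapAlg A F ≫ Spec.map σ = specMapAlg K F := by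
    rw [specMapAlg, ← Spec.map_comp]; rfl
  rw [h]
  exact isIntegral_of_iso (pullbackSpecIso K F L)

/-- Geometric integrality passes from `X` to `Y`, for `Y ⟶ X` an integral morphism from an integral
scheme admitting a section over the generic point of `X`. -/
lemma isGeometricallyIntegral_comp_of_lift {K : Type u} [Field K] {X Y : Scheme.{u}}
    (t : X ⟶ SpecOf K) (hX : IsGeometricallyIntegral t) [IsIntegral X] [IsIntegral Y]
    (ν : Y ⟶ X) [IsIntegralHom ν]
    (H : ∀ (F : Type u) [Field F] (g : SpecOf F ⟶ X), IsDominant g →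
      ∃ h : SpecOf F ⟶ Y, h ≫ ν = g) :
    IsGeometricallyIntegral (ν ≫ t) := by
  intro L _ _
  obtain ⟨A, i, _, _⟩ : ∃ (A : CommRingCat.{u}) (i : Spec A ⟶ X), IsOpenImmersion i ∧
      Nonempty (Spec A) := by
    obtain ⟨x⟩ : Nonempty X := inferInstance
    exact ⟨_, X.affineOpenCover.f (X.affineOpenCover.idx x), inferInstance,
      ⟨(X.affineOpenCover.covers x).choose⟩⟩
  have : IsDomain A := (affine_isIntegral_iff A).mp (isIntegral_of_isOpenImmersion i)
  let F := FractionRing A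
  have : IsDominant i := isDominant_of_isOpenImmersion i
  have : IsDominant (specMapAlg A F) :=
    isDominant_specMap_of_injective _ (FaithfulSMul.algebraMap_injective A F)
  obtain ⟨h, hh⟩ := H F (specMapAlg A F ≫ i) inferInstance
  let k : SpecOf F ⟶ pullback ν i := pullback.lift h (specMapAlg A F) hh
  have : Nonempty ↥(pullback ν i) := ⟨k.base default⟩
  have : IsIntegral (pullback ν i) := isIntegral_of_isOpenImmersion (pullback.fst ν i)
  have : IsDominant k := isDominant_of_comp_isIntegralHom (pullback.snd ν i) k
    (pullback.lift_snd _ _ _)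
  have : IsDominant (pullback.fst ν i) := isDominant_of_isOpenImmersion _
  have : IsDominant h := by
    rw [← pullback.lift_fst (f := ν) (g := i) h (specMapAlg A F) hh]
    exact inferInstanceAs (IsDominant (k ≫ pullback.fst ν i))
  have : IsSchemeTheoreticallyDominant h := .of_isDominant h
  have : IsIntegral (pullback (i ≫ t) (specMapAlg K L)) := by
    have : IsIntegral (pullback t (specMapAlg K L)) := hX L
    have : IsIntegral (pullback i (pullback.fst t (specMapAlg K L))) :=
      have : Nonempty ↥(pullback i (pullback.fst t (specMapAlg K L))) := by
        have : Surjective (specMapAlg K L) := ⟨fun x ↦ ⟨default, Subsingleton.elim _ _⟩⟩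
        exact (inferInstance : Nonempty (Spec A)).map fun x ↦
          ((pullback.fst i (pullback.fst t (specMapAlg K L))).surjective x).choose
      isIntegral_of_isOpenImmersion (pullback.snd i (pullback.fst t (specMapAlg K L)))
    exact isIntegral_of_iso (pullbackRightPullbackFstIso t (specMapAlg K L) i).symm
  have : IsIntegral (pullback (specMapAlg A F ≫ i ≫ t) (specMapAlg K L)) :=
    isIntegral_pullback_fractionRing (i ≫ t)
  have : IsIntegral (pullback h (pullback.fst (ν ≫ t) (specMapAlg K L))) := by
    refine isIntegral_of_iso (pullbackRightPullbackFstIso (ν ≫ t) (specMapAlg K L) h ≪≫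
      pullback.congrHom (f₂ := specMapAlg A F ≫ i ≫ t) ?_ rfl)
    rw [← Category.assoc, hh, Category.assoc]
  have : Flat (specMapAlg K L) :=
    Flat.SpecMap_iff.mpr (RingHom.flat_algebraMap_iff.mpr inferInstance)
  change IsIntegral (pullback (ν ≫ t) (specMapAlg K L))
  exact isIntegral_of_isSchemeTheoreticallyDominant
    (pullback.snd h (pullback.fst (ν ≫ t) (specMapAlg K L)))

/-- the normalization of a base change of a normal geometrically
integral `K`-scheme of finite type is geometrically integral over `K'`. -/
theorem stmt_0 {K K' : Type u} [Field K] [Field K'] [Algebra K K']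
    (p : ℕ) (hp : 0 < p) [CharP K p]
    {X : Scheme.{u}} (f : X ⟶ SpecOf K) [LocallyOfFiniteType f] [QuasiCompact f]
    (hXnormal : IsNormalScheme X) (hXgi : IsGeometricallyIntegral f)
    {Y' : Scheme.{u}} (ν : Y' ⟶ baseChange f K') (hν : IsNormalization ν) :
    IsGeometricallyIntegral (ν ≫ baseChangeStruct f K') := by
  have hX' : IsGeometricallyIntegral (baseChangeStruct f K') := by
    rw [isGeometricallyIntegral_iff] at hXgi ⊢
    exact inferInstanceAs (GeometricallyIntegral (pullback.snd f (specMapAlg K K')))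
  have := hXgi K'
  obtain ⟨⟨_, -⟩, _, -, hlift⟩ := hν
  exact isGeometricallyIntegral_comp_of_lift _ hX' ν fun F _ g hg ↦
    (hlift _ g (isNormalScheme_spec_field F) hg).exists
end

section
/- Let K be a field of characteristic p > 0 and X a geometrically integral normal K-scheme of finite type. There exists n₀ ≥ 0 such that for all n ≥ n₀, the normalization of the iterated Frobenius pullback X^{(p^n)} is geometrically normal over K. -/
open AlgebraicGeometry CategoryTheory CategoryTheory.Limits

section NormalityCriteria

open Polynomial

theorem IsIntegrallyClosed.dvd_of_eval_scaleRoots_eq_zero {R : Type*} [CommRing R] [IsDomain R]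
    [IsIntegrallyClosed R] {a b : R} {f : R[X]} (hf : f.Monic) (hb : b ≠ 0)
    (h : (f.scaleRoots b).eval a = 0) : b ∣ a := by
  let F := FractionRing R
  have hb' : algebraMap R F b ≠ 0 := by simpa using hb
  have hint : IsIntegral R (algebraMap R F a / algebraMap R F b) := by
    refine ⟨f, hf, ?_⟩
    have h1 : (f.scaleRoots b).eval₂ (algebraMap R F)
        (algebraMap R F b * (algebraMap R F a / algebraMap R F b)) = 0 := by
      rw [mul_div_cancel₀ _ hb', Polynomial.eval₂_at_apply, h, map_zero]
    rw [scaleRoots_eval₂_mul] at h1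
    exact (mul_eq_zero.1 h1).resolve_left (pow_ne_zero _ hb')
  obtain ⟨y, hy⟩ := IsIntegrallyClosed.isIntegral_iff.1 hint
  refine ⟨y, IsFractionRing.injective R F ?_⟩
  rw [map_mul, hy, mul_div_cancel₀ _ hb']

theorem isIntegrallyClosed_of_dvd {R : Type*} [CommRing R] [IsDomain R]
    (H : ∀ (a b : R) (f : R[X]), f.Monic → b ≠ 0 → (f.scaleRoots b).eval a = 0 → b ∣ a) :
    IsIntegrallyClosed R := by
  refine (isIntegrallyClosed_iff (FractionRing R)).2 fun {x} hx => ?_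
  obtain ⟨f, hf, hfx⟩ := hx
  obtain ⟨a, b, rfl⟩ := IsLocalization.exists_mk'_eq (nonZeroDivisors R) x
  obtain ⟨c, rfl⟩ := H a b f hf (nonZeroDivisors.ne_zero b.2) (by
    have := scaleRoots_aeval_eq_zero_of_aeval_mk'_eq_zero (p := f) hfx
    rw [aeval_algebraMap_apply] at this
    simpa using this)
  exact ⟨c, by rw [IsLocalization.mk'_mul_cancel_left]⟩

theorem IsIntegrallyClosed.of_dvd_reflecting {R S : Type*} [CommRing R] [CommRing S] [IsDomain R]
    [IsDomain S] [IsIntegrallyClosed S] (φ : R →+* S) (hφ : Function.Injective φ)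
    (H : ∀ a b, φ b ∣ φ a → b ∣ a) : IsIntegrallyClosed R := by
  refine isIntegrallyClosed_of_dvd fun a b f hf hb h => H a b ?_
  refine IsIntegrallyClosed.dvd_of_eval_scaleRoots_eq_zero (hf.map φ)
    ((map_ne_zero_iff φ hφ).2 hb) ?_
  rw [← map_scaleRoots f b φ (by simp [hf.leadingCoeff]), eval_map_apply, h, map_zero]

theorem IsIntegrallyClosed.of_forall_finset {R : Type*} [CommRing R] [IsDomain R]
    (H : ∀ s : Finset R, ∃ (S : Type _) (_ : CommRing S) (φ : S →+* R), IsDomain S ∧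
      IsIntegrallyClosed S ∧ Function.Injective φ ∧ ∀ x ∈ s, x ∈ φ.range) :
    IsIntegrallyClosed R := by
  classical
  refine isIntegrallyClosed_of_dvd fun a b f hf hb h => ?_
  obtain ⟨S, _, φ, _, _, hφ, hs⟩ := H ({a, b} ∪ f.coeffs)
  obtain ⟨a', rfl⟩ := hs a (by simp)
  obtain ⟨b', rfl⟩ := hs b (by simp)
  have hl : f ∈ lifts φ := by
    rw [lifts_iff_coeff_lifts]
    intro n
    by_cases hn : f.coeff n = 0
    · exact ⟨0, by simp [hn]⟩
    · exact hs _ (by simp only [Finset.mem_union]; exact Or.inr (coeff_mem_coeffs hn))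
  obtain ⟨g, rfl, -, hg⟩ := lifts_and_degree_eq_and_monic hl hf
  refine map_dvd φ (IsIntegrallyClosed.dvd_of_eval_scaleRoots_eq_zero hg
    (by rintro rfl; simp at hb) (hφ ?_))
  rw [map_zero, ← h, ← map_scaleRoots g b' φ (by rw [hg.leadingCoeff, map_one]; exact one_ne_zero), eval_map_apply]

instance MvPolynomial.isIntegrallyClosed_of_finite {σ R : Type*} [Finite σ] [CommRing R]
    [IsDomain R] [IsIntegrallyClosed R] : IsIntegrallyClosed (MvPolynomial σ R) := by
  suffices H : ∀ n, IsIntegrallyClosed (MvPolynomial (Fin n) R) by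
    obtain ⟨n, ⟨e⟩⟩ := Finite.exists_equiv_fin σ
    have := H n
    exact IsIntegrallyClosed.of_equiv (MvPolynomial.renameEquiv R e).symm.toRingEquiv
  intro n
  induction n with
  | zero => exact IsIntegrallyClosed.of_equiv (MvPolynomial.isEmptyRingEquiv R (Fin 0)).symm
  | succ n ih => exact IsIntegrallyClosed.of_equiv (MvPolynomial.finSuccEquiv R n).symm.toRingEquiv

end NormalityCriteria

namespace GeometricNormality

open TensorProduct

theorem isIntegrallyClosed_fractionRing_mvPolynomial_tensor {k E B σ : Type*} [Finite σ] [Field k]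
    [Field E] [CommRing B] [IsDomain B] [IsIntegrallyClosed B] [Algebra k B] [Algebra k E]
    [Algebra (MvPolynomial σ k) E] [IsScalarTower k (MvPolynomial σ k) E]
    [IsFractionRing (MvPolynomial σ k) E] :
    IsDomain (E ⊗[k] B) ∧ IsIntegrallyClosed (E ⊗[k] B) := by
  let e : MvPolynomial σ k ⊗[k] B ≃ₐ[k] MvPolynomial σ B :=
    (Algebra.TensorProduct.comm k (MvPolynomial σ k) B).trans
      ((MvPolynomial.algebraTensorAlgEquiv k B).restrictScalars k)
  have hd : IsDomain (MvPolynomial σ k ⊗[k] B) := e.toMulEquiv.isDomain _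
  have hi : IsIntegrallyClosed (MvPolynomial σ k ⊗[k] B) := .of_equiv e.symm.toRingEquiv
  let φ := Algebra.TensorProduct.map (Algebra.ofId (MvPolynomial σ k) E) (AlgHom.id k B)
  let := φ.toAlgebra
  have hloc : IsLocalization (Algebra.algebraMapSubmonoid (MvPolynomial σ k ⊗[k] B)
      (nonZeroDivisors (MvPolynomial σ k))) (E ⊗[k] B) := by
    refine IsLocalization.tensorProduct_tensorProduct _ _ _ _ ?_
    ext; simp [RingHom.algebraMap_toAlgebra, φ]
  have hle : Algebra.algebraMapSubmonoid (MvPolynomial σ k ⊗[k] B)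
      (nonZeroDivisors (MvPolynomial σ k)) ≤ nonZeroDivisors _ := by
    rintro _ ⟨x, hx, rfl⟩
    refine mem_nonZeroDivisors_of_ne_zero ?_
    have : Function.Injective (algebraMap (MvPolynomial σ k) (MvPolynomial σ k ⊗[k] B)) :=
      Algebra.TensorProduct.includeLeft_injective (S := k) (algebraMap k B).injective
    exact (map_ne_zero_iff _ this).2 (nonZeroDivisors.ne_zero hx)
  exact ⟨IsLocalization.isDomain_of_le_nonZeroDivisors _ hle,
    isIntegrallyClosed_of_isLocalization _ _ hle⟩

theorem isIntegrallyClosed_tensor_of_isSeparable {E L D : Type*} [Field E] [Field L]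
    [Algebra E L] [FiniteDimensional E L] [Algebra.IsSeparable E L] [CommRing D] [Algebra E D]
    [IsDomain D] [IsIntegrallyClosed D] [IsDomain (D ⊗[E] L)] : IsIntegrallyClosed (D ⊗[E] L) := by
  let S := D ⊗[E] L
  let G := FractionRing D
  have : Algebra.FormallyEtale E L := Algebra.FormallyEtale.of_isSeparable E L
  have : Algebra.FinitePresentation E L := Algebra.FinitePresentation.of_finiteType.1 inferInstance
  have : Algebra.Smooth E L := ⟨inferInstance, inferInstance⟩
  have hb := TensorProduct.toIntegralClosure_bijective_of_smooth (R := D) (S := S) (B := G)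
  have : IsIntegrallyClosedIn S (S ⊗[D] G) := by
    refine isIntegrallyClosedIn_iff.2 ⟨?_, fun {x} hx => ?_⟩
    · exact Algebra.TensorProduct.includeLeft_injective (S := D) (IsFractionRing.injective D G)
    · obtain ⟨y, hy⟩ := hb.2 ⟨x, hx⟩
      have hy' := congrArg Subtype.val hy
      simp only at hy'
      rw [← hy']
      clear hy hy'
      induction y with
      | zero => exact ⟨0, by simp⟩
      | add y z hy hz =>
        obtain ⟨y', hy'⟩ := hy
        obtain ⟨z', hz'⟩ := hz
        exact ⟨y' + z', by simp [hy', hz']⟩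
      | tmul s c =>
        obtain ⟨d, hd⟩ := IsIntegrallyClosed.isIntegral_iff.1 c.2
        refine ⟨s * algebraMap D S d, ?_⟩
        simp only [TensorProduct.toIntegralClosure, AlgHom.coe_codRestrict,
          Algebra.TensorProduct.map_tmul, AlgHom.coe_id, id, Subalgebra.coe_val]
        rw [← hd, Algebra.TensorProduct.algebraMap_apply, Algebra.algebraMap_eq_smul_one d,
          mul_smul_comm, mul_one, Algebra.algebraMap_eq_smul_one (A := G), TensorProduct.tmul_smul,
          TensorProduct.smul_tmul']
        rfl
  have hle : Algebra.algebraMapSubmonoid S (nonZeroDivisors D) ≤ nonZeroDivisors S := by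
    rintro _ ⟨x, hx, rfl⟩
    refine mem_nonZeroDivisors_of_ne_zero ?_
    have : Function.Injective (algebraMap D S) :=
      Algebra.TensorProduct.includeLeft_injective (S := E) (algebraMap E L).injective
    exact (map_ne_zero_iff _ this).2 (nonZeroDivisors.ne_zero hx)
  have : IsDomain (S ⊗[D] G) :=
    IsLocalization.isDomain_of_le_nonZeroDivisors (S ⊗[D] G) hle
  have : IsIntegrallyClosed (S ⊗[D] G) := by
    have : Algebra.IsIntegral G (G ⊗[D] S) := inferInstance
    have hf : IsField (G ⊗[D] S) := by
      have : IsDomain (G ⊗[D] S) := (Algebra.TensorProduct.comm D G S).toMulEquiv.isDomain _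
      exact isField_of_isIntegral_of_isField' (Field.toIsField G)
    have hf' : IsField (S ⊗[D] G) := (Algebra.TensorProduct.comm D S G).toMulEquiv.isField hf
    let := hf'.toField
    infer_instance
  exact .of_isIntegrallyClosed_of_isIntegrallyClosedIn S (S ⊗[D] G)

theorem isIntegrallyClosed_tensor_of_isSeparable_tower {k E L B : Type*} [Field k] [Field E]
    [Field L] [Algebra k E] [Algebra k L] [Algebra E L] [IsScalarTower k E L] [CommRing B]
    [Algebra k B] [FiniteDimensional E L] [Algebra.IsSeparable E L] [IsDomain (E ⊗[k] B)]
    [IsIntegrallyClosed (E ⊗[k] B)] [IsDomain (L ⊗[k] B)] : IsIntegrallyClosed (L ⊗[k] B) := by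
  let e'' : (E ⊗[k] B) ⊗[E] L ≃+* L ⊗[k] B :=
    (Algebra.TensorProduct.comm E (E ⊗[k] B) L).toRingEquiv.trans
      (Algebra.TensorProduct.cancelBaseChange k E E L B).toRingEquiv
  have : IsDomain ((E ⊗[k] B) ⊗[E] L) := MulEquiv.isDomain (L ⊗[k] B) e''.toMulEquiv
  have := isIntegrallyClosed_tensor_of_isSeparable (E := E) (L := L) (D := E ⊗[k] B)
  exact .of_equiv e''

theorem isIntegrallyClosed_tensor_of_perfectField_of_essFiniteType {k L B : Type*} [Field k]
    [PerfectField k] [Field L] [Algebra k L] [Algebra.EssFiniteType k L] [CommRing B] [IsDomain B]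
    [IsIntegrallyClosed B] [Algebra k B] [IsDomain (L ⊗[k] B)] : IsIntegrallyClosed (L ⊗[k] B) := by
  obtain ⟨s, hs, hsep⟩ := exists_isTranscendenceBasis_and_isSeparable_of_perfectField k L
  have hsep' : Algebra.IsSeparable
      (IntermediateField.adjoin k (Set.range ((↑) : s → L))) L := by
    convert! hsep <;> simp
  clear hsep
  let E := IntermediateField.adjoin k (Set.range ((↑) : s → L))
  have : Algebra.EssFiniteType E L := Algebra.EssFiniteType.of_comp k E L
  have : Algebra.FormallyUnramified E L := Algebra.FormallyUnramified.of_isSeparable E L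
  have : FiniteDimensional E L := Algebra.FormallyUnramified.finite_of_free E L
  let e : FractionRing (MvPolynomial s k) ≃ₐ[k] E := hs.1.aevalEquivField
  obtain ⟨h1, h2⟩ := isIntegrallyClosed_fractionRing_mvPolynomial_tensor (k := k)
    (E := FractionRing (MvPolynomial s k)) (B := B) (σ := s)
  let e' : FractionRing (MvPolynomial s k) ⊗[k] B ≃ₐ[k] E ⊗[k] B :=
    Algebra.TensorProduct.congr e AlgEquiv.refl
  have : IsDomain (E ⊗[k] B) := e'.symm.toMulEquiv.isDomain _
  have : IsIntegrallyClosed (E ⊗[k] B) := .of_equiv e'.toRingEquiv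
  exact isIntegrallyClosed_tensor_of_isSeparable_tower (E := E)

theorem exists_fg_intermediateField_mem_range {k L B : Type*} [Field k] [Field L] [Algebra k L]
    [CommRing B] [Algebra k B] (s : Finset (L ⊗[k] B)) : ∃ F : IntermediateField k L, F.FG ∧
      ∀ x ∈ s, x ∈ (Algebra.TensorProduct.map F.val (AlgHom.id k B)).range := by
  classical
  have mono : ∀ F G : IntermediateField k L, F ≤ G →
      (Algebra.TensorProduct.map F.val (AlgHom.id k B)).range ≤
      (Algebra.TensorProduct.map G.val (AlgHom.id k B)).range := by
    rintro F G h _ ⟨y, rfl⟩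
    refine ⟨Algebra.TensorProduct.map (IntermediateField.inclusion h) (AlgHom.id k B) y, ?_⟩
    induction y with
    | zero => simp
    | add a b ha hb => simp only [map_add, ← ha, ← hb]
    | tmul a b => rfl
  have key : ∀ x : L ⊗[k] B, ∃ F : IntermediateField k L, F.FG ∧
      x ∈ (Algebra.TensorProduct.map F.val (AlgHom.id k B)).range := by
    intro x
    induction x with
    | zero => exact ⟨⊥, IntermediateField.fg_bot, zero_mem _⟩
    | add x y hx hy =>
      obtain ⟨F, hF, hx⟩ := hx
      obtain ⟨G, hG, hy⟩ := hy
      exact ⟨F ⊔ G, IntermediateField.fg_sup hF hG, add_mem (mono _ _ le_sup_left hx) (mono _ _ le_sup_right hy)⟩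
    | tmul a b =>
      refine ⟨IntermediateField.adjoin k {a}, IntermediateField.fg_adjoin_of_finite (Set.finite_singleton a), ?_⟩
      exact ⟨⟨a, IntermediateField.mem_adjoin_simple_self k a⟩ ⊗ₜ b, rfl⟩
  induction s using Finset.induction_on with
  | empty => exact ⟨⊥, IntermediateField.fg_bot, by simp⟩
  | insert x s hx ih =>
    obtain ⟨F, hF, hFs⟩ := ih
    obtain ⟨G, hG, hGx⟩ := key x
    refine ⟨F ⊔ G, IntermediateField.fg_sup hF hG, fun y hy => ?_⟩
    rcases Finset.mem_insert.1 hy with rfl | hy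
    · exact mono _ _ le_sup_right hGx
    · exact mono _ _ le_sup_left (hFs y hy)

theorem isIntegrallyClosed_tensor_of_perfectField {k L B : Type*} [Field k]
    [PerfectField k] [Field L] [Algebra k L] [CommRing B] [IsDomain B]
    [IsIntegrallyClosed B] [Algebra k B] [IsDomain (L ⊗[k] B)] : IsIntegrallyClosed (L ⊗[k] B) := by
  refine IsIntegrallyClosed.of_forall_finset fun s => ?_
  obtain ⟨F, hF, hs⟩ := exists_fg_intermediateField_mem_range s
  have : Algebra.EssFiniteType k F := IntermediateField.essFiniteType_iff.2 hF
  let φ : F ⊗[k] B →ₐ[k] L ⊗[k] B := Algebra.TensorProduct.map F.val (AlgHom.id k B)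
  have hφ : Function.Injective φ :=
    Module.Flat.rTensor_preserves_injective_linearMap F.val.toLinearMap F.val.injective
  have : IsDomain (F ⊗[k] B) := hφ.isDomain φ.toRingHom
  exact ⟨F ⊗[k] B, inferInstance, φ.toRingHom, inferInstance,
    isIntegrallyClosed_tensor_of_perfectField_of_essFiniteType, hφ, hs⟩

end GeometricNormality

theorem RingHom.Finite.of_comp_injective {R B C : Type*} [CommRing R] [CommRing B] [CommRing C]
    [IsNoetherianRing R] {f : R →+* B} {g : B →+* C} (hg : Function.Injective g)
    (h : (g.comp f).Finite) : f.Finite := by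
  algebraize [f, g, g.comp f]
  exact Module.Finite.of_injective (IsScalarTower.toAlgHom R B C).toLinearMap hg

theorem FiniteDimensional.of_essFiniteType_of_isAlgebraic (F Q : Type*) [Field F] [Field Q]
    [Algebra F Q] [Algebra.EssFiniteType F Q] [Algebra.IsAlgebraic F Q] :
    FiniteDimensional F Q := by
  obtain ⟨s, hs⟩ := IntermediateField.fg_top F Q
  have : FiniteDimensional F (IntermediateField.adjoin F (s : Set Q)) :=
    IntermediateField.finiteDimensional_adjoin fun x _ => (Algebra.IsAlgebraic.isAlgebraic x).isIntegral
  rw [hs] at this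
  exact Module.Finite.equiv IntermediateField.topEquiv.toLinearEquiv

theorem finite_integralClosure_of_finite_iterateFrobenius {R Q : Type*} [CommRing R] [IsDomain R]
    [IsNoetherianRing R] [IsIntegrallyClosed R] (p : ℕ) [Fact p.Prime] [CharP R p]
    (hR : ∀ n, (iterateFrobenius R p n).Finite) (F : Type*) [Field F] [Algebra R F]
    [IsFractionRing R F] [Field Q] [Algebra R Q] [Algebra F Q] [IsScalarTower R F Q]
    [FiniteDimensional F Q] : Module.Finite R (integralClosure R Q) := by
  have : CharP F p := charP_of_injective_algebraMap (IsFractionRing.injective R F) p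
  let S := separableClosure F Q
  have : IsScalarTower R S Q := ⟨fun r s q => smul_mul_assoc r (s : Q) q⟩
  have : CharP S p := charP_of_injective_algebraMap (algebraMap F S).injective p
  let m := IsPurelyInseparable.exponent S Q
  let h : Q →+* S := IsPurelyInseparable.iterateFrobenius S Q p le_rfl
  have hh (x : Q) : algebraMap S Q (h x) = x ^ p ^ m :=
    IsPurelyInseparable.algebraMap_iterateFrobenius S p le_rfl x
  have : Module.Finite R (integralClosure R S) :=
    IsIntegralClosure.finite R F S (integralClosure R S)
  let g : integralClosure R Q →+* integralClosure R S :=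
    (h.comp (integralClosure R Q).val.toRingHom).codRestrict (integralClosure R S) fun x => by
      rw [mem_integralClosure_iff, ← isIntegral_algebraMap_iff (algebraMap S Q).injective]
      change IsIntegral R (algebraMap S Q (h x))
      rw [hh]
      exact IsIntegral.pow x.2 _
  have hg : Function.Injective g := fun x y hxy =>
    Subtype.ext (h.injective (congrArg Subtype.val hxy))
  have hcomp : g.comp (algebraMap R (integralClosure R Q)) =
      (algebraMap R (integralClosure R S)).comp (iterateFrobenius R p m) := by
    ext x
    change algebraMap S Q (h (algebraMap R Q x)) = algebraMap S Q (algebraMap R S _)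
    rw [hh, ← IsScalarTower.algebraMap_apply, iterateFrobenius_def, map_pow]
  rw [← RingHom.finite_algebraMap]
  refine RingHom.Finite.of_comp_injective hg ?_
  rw [hcomp]
  exact (RingHom.finite_algebraMap.2 this).comp (hR m)

theorem MvPolynomial.finite_iterateFrobenius {σ k : Type*} [Finite σ] [Field k] (p : ℕ)
    [Fact p.Prime] [CharP k p] [PerfectField k] (n : ℕ) :
    (iterateFrobenius (MvPolynomial σ k) p n).Finite := by
  have : PerfectRing k p := PerfectField.toPerfectRing p
  refine RingHom.IsIntegral.to_finite ?_ ?_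
  · intro x
    refine ⟨Polynomial.X ^ p ^ n - Polynomial.C x, Polynomial.monic_X_pow_sub_C _ (by
      exact (pow_pos (Fact.out : p.Prime).pos n).ne'), ?_⟩
    simp [iterateFrobenius_def]
  · refine RingHom.FiniteType.of_comp_finiteType (f := algebraMap k (MvPolynomial σ k)) ?_
    have : (iterateFrobenius (MvPolynomial σ k) p n).comp (algebraMap k (MvPolynomial σ k)) =
        (algebraMap k (MvPolynomial σ k)).comp (iterateFrobenius k p n) := by
      ext x; simp [iterateFrobenius_def]
    rw [this]
    refine RingHom.FiniteType.comp (RingHom.finiteType_algebraMap.2 inferInstance)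
      (RingHom.FiniteType.of_surjective _ ?_)
    exact (bijective_iterateFrobenius k p n).2

theorem finite_integralClosure_of_perfectField (k : Type*) {A Q : Type*} [Field k] [PerfectField k]
    (p : ℕ) [Fact p.Prime] [CharP k p] [CommRing A] [IsDomain A] [Algebra k A]
    [Algebra.FiniteType k A] [Field Q] [Algebra A Q] [IsFractionRing A Q] :
    Module.Finite A (integralClosure A Q) := by
  obtain ⟨s, g, hg, hgf⟩ := exists_finite_inj_algHom_of_fg k A
  let R := MvPolynomial (Fin s) k
  let F := FractionRing R
  algebraize [g.toRingHom]
  have hRA : Function.Injective (algebraMap R A) := hg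
  have : Module.Finite R A := hgf
  let : Algebra R Q := ((algebraMap A Q).comp (algebraMap R A)).toAlgebra
  have : IsScalarTower R A Q := .of_algebraMap_eq fun _ => rfl
  have hRQ : Function.Injective (algebraMap R Q) := (IsFractionRing.injective A Q).comp hRA
  have : FaithfulSMul R Q := (faithfulSMul_iff_algebraMap_injective R Q).2 hRQ
  let : Algebra F Q := FractionRing.liftAlgebra R Q
  have : IsScalarTower R F Q := FractionRing.isScalarTower_liftAlgebra R Q
  have : Algebra.EssFiniteType A Q := Algebra.EssFiniteType.of_isLocalization Q (nonZeroDivisors A)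
  have : Algebra.EssFiniteType R Q := Algebra.EssFiniteType.comp R A Q
  have : Algebra.EssFiniteType F Q := Algebra.EssFiniteType.of_comp R F Q
  have : Algebra.IsAlgebraic F Q := isAlgebraic_of_isFractionRing R A F Q
  have : FiniteDimensional F Q := .of_essFiniteType_of_isAlgebraic F Q
  have hfin : Module.Finite R (integralClosure R Q) :=
    finite_integralClosure_of_finite_iterateFrobenius p (MvPolynomial.finite_iterateFrobenius p) F
  let g : integralClosure A Q →ₗ[R] integralClosure R Q :=
    LinearMap.codRestrict (Subalgebra.toSubmodule (integralClosure R Q))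
      (((integralClosure A Q).val.restrictScalars R).toLinearMap)
      fun x => isIntegral_trans (R := R) x.1 x.2
  have : Module.Finite R (integralClosure A Q) := Module.Finite.of_injective g
    fun x y h => Subtype.ext (Subtype.ext_iff (a1 := g x).1 h :)
  exact Module.Finite.of_restrictScalars_finite R A _

namespace GeometricNormality

open TensorProduct

universe u

/-- The integral closure of the domain `R` in any of its fraction fields is generated, as an
`R`-module, by the fractions `t / s` with `t ∈ T`. -/
def IntegralClosureGeneratedBy (R : Type u) [CommRing R] (T : Set R) (s : R) : Prop :=
  ∀ (Q : Type u) [Field Q] [Algebra R Q] [IsFractionRing R Q],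
    (∀ t ∈ T, IsIntegral R (algebraMap R Q t / algebraMap R Q s)) ∧
    ∀ x : Q, IsIntegral R x →
      x ∈ Submodule.span R ((fun t => algebraMap R Q t / algebraMap R Q s) '' T)

theorem exists_integralClosureGeneratedBy (R : Type u) [CommRing R] [IsDomain R]
    [Module.Finite R (integralClosure R (FractionRing R))] :
    ∃ (T : Finset R) (s : R), s ≠ 0 ∧ IntegralClosureGeneratedBy R T s := by
  classical
  let F := FractionRing R
  obtain ⟨G, hG⟩ := Module.Finite.fg_top (R := R) (M := integralClosure R F)
  obtain ⟨⟨s, hs⟩, hsG⟩ := IsLocalization.exist_integer_multiples_of_finset (nonZeroDivisors R)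
    (G.image Subtype.val)
  have hs0 := nonZeroDivisors.ne_zero hs
  have key : ∀ g : integralClosure R F, ∃ t : R, g ∈ G → algebraMap R F t = s • g.1 := by
    intro g
    by_cases hg : g ∈ G
    · obtain ⟨t, ht⟩ := hsG g.1 (Finset.mem_image_of_mem _ hg)
      exact ⟨t, fun _ => ht⟩
    · exact ⟨0, fun h => absurd h hg⟩
  choose t ht using key
  refine ⟨G.image t, s, hs0, fun Q _ _ _ => ?_⟩
  let e : F ≃ₐ[R] Q := FractionRing.algEquiv R Q
  have hsQ : algebraMap R Q s ≠ 0 :=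
    (map_ne_zero_iff _ (IsFractionRing.injective R Q)).2 hs0
  have het : ∀ g ∈ G, algebraMap R Q (t g) / algebraMap R Q s = e g.1 := by
    intro g hg
    rw [div_eq_iff hsQ, ← e.commutes (t g), ht g hg, map_smul, Algebra.smul_def, mul_comm]
  constructor
  · intro x hx
    simp only [Finset.coe_image, Set.mem_image] at hx
    obtain ⟨g, hg, rfl⟩ := hx
    rw [het g hg]
    exact g.2.map e
  · intro x hx
    have hx' : IsIntegral R (e.symm x) := hx.map e.symm
    have hmem : (⟨e.symm x, hx'⟩ : integralClosure R F) ∈ Submodule.span R (G : Set _) := by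
      rw [hG]; trivial
    have := Submodule.mem_map_of_mem (f := e.toLinearMap ∘ₗ
      (integralClosure R F).val.toLinearMap) hmem
    rw [Submodule.map_span] at this
    convert this using 1
    · congr 1
      ext y
      simp only [Finset.coe_image, Set.mem_image, exists_exists_and_eq_and]
      refine exists_congr fun g => and_congr_right fun hg => ?_
      rw [het g hg]; rfl
    · exact (e.apply_symm_apply x).symm

theorem isIntegrallyClosed_of_integralClosureGeneratedBy {A R C D : Type u} [CommRing A]
    [CommRing R] [CommRing C] [CommRing D] [IsDomain C] [IsDomain D]
    [IsIntegrallyClosed C] [Algebra A R] [Algebra A C] [Algebra R D] [Algebra C D] [Algebra A D]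
    [IsScalarTower A R D] [IsScalarTower A C D] [FaithfulSMul A C] [FaithfulSMul R D]
    [FaithfulSMul C D] [Algebra.IsIntegral A R] [Algebra.IsIntegral R D] {T : Set R} {s : A}
    (hs : s ≠ 0) (hT : T ⊆ Set.range (algebraMap A R))
    (H : IntegralClosureGeneratedBy R T (algebraMap A R s))
    (hbir : ∀ d : D, ∃ r : R, r ≠ 0 ∧ ∃ r' : R, algebraMap R D r' = algebraMap R D r * d) :
    IsIntegrallyClosed D := by
  have hAC := FaithfulSMul.algebraMap_injective A C
  have hRD := FaithfulSMul.algebraMap_injective R D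
  have hCD := FaithfulSMul.algebraMap_injective C D
  have : IsDomain R := hRD.isDomain _
  suffices main : ∀ (Q : Type u) [Field Q] [Algebra D Q] [IsFractionRing D Q],
      IsIntegrallyClosed D from main (FractionRing D)
  intro Q _ _ _
  have hDQ : Function.Injective (algebraMap D Q) := IsFractionRing.injective D Q
  let : Algebra R Q := ((algebraMap D Q).comp (algebraMap R D)).toAlgebra
  let : Algebra C Q := ((algebraMap D Q).comp (algebraMap C D)).toAlgebra
  let : Algebra A Q := ((algebraMap D Q).comp (algebraMap A D)).toAlgebra
  have : IsScalarTower R D Q := .of_algebraMap_eq fun _ => rfl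
  have : IsScalarTower C D Q := .of_algebraMap_eq fun _ => rfl
  have : IsScalarTower A D Q := .of_algebraMap_eq fun _ => rfl
  have : IsScalarTower A R Q := .of_algebraMap_eq fun a => by
    rw [IsScalarTower.algebraMap_apply A D Q, IsScalarTower.algebraMap_apply A R D,
      ← IsScalarTower.algebraMap_apply R D Q]
  have : IsScalarTower A C Q := .of_algebraMap_eq fun a => by
    rw [IsScalarTower.algebraMap_apply A D Q, IsScalarTower.algebraMap_apply A C D,
      ← IsScalarTower.algebraMap_apply C D Q]
  have hRQ : Function.Injective (algebraMap R Q) := hDQ.comp hRD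
  have hCQ : Function.Injective (algebraMap C Q) := hDQ.comp hCD
  have : FaithfulSMul R Q := (faithfulSMul_iff_algebraMap_injective R Q).2 hRQ
  have : IsFractionRing R Q := by
    refine IsFractionRing.of_field R Q fun z => ?_
    obtain ⟨x, y, hy, rfl⟩ := IsFractionRing.div_surjective (A := D) z
    obtain ⟨r, hr, r', hr'⟩ := hbir x
    obtain ⟨q, hq, q', hq'⟩ := hbir y
    have hr0 := (map_ne_zero_iff _ hRQ).2 hr
    have hq0 := (map_ne_zero_iff _ hRQ).2 hq
    have hy0 := (map_ne_zero_iff _ hDQ).2 (nonZeroDivisors.ne_zero hy)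
    refine ⟨r' * q, r * q', ?_⟩
    simp only [map_mul, IsScalarTower.algebraMap_apply R D Q, hr', hq']
    simp only [IsScalarTower.algebraMap_apply R D Q] at hr0 hq0
    field_simp
  refine (isIntegrallyClosed_iff Q).2 fun {x} hx => ?_
  obtain ⟨hint, hspan⟩ := H Q
  have hxs := hspan x (isIntegral_trans (R := R) (A := D) x hx)
  have hsQ : algebraMap A Q s ≠ 0 := by
    rw [IsScalarTower.algebraMap_apply A C Q]
    exact (map_ne_zero_iff _ hCQ).2 ((map_ne_zero_iff _ hAC).2 hs)
  suffices Submodule.span R ((fun t => algebraMap R Q t / algebraMap R Q (algebraMap A R s)) '' T) ≤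
      LinearMap.range (IsScalarTower.toAlgHom R D Q).toLinearMap from this hxs
  rw [Submodule.span_le]
  rintro _ ⟨t, ht, rfl⟩
  obtain ⟨a, rfl⟩ := hT ht
  have h1 : IsIntegral C (algebraMap A Q a / algebraMap A Q s) := by
    have := hint _ ht
    simp only [← IsScalarTower.algebraMap_apply A R Q] at this
    exact (isIntegral_trans (R := A) _ this).tower_top
  let F := FractionRing C
  let : Algebra F Q := (IsFractionRing.lift (A := C) (K := F) hCQ).toAlgebra
  have hF : ∀ c, algebraMap F Q (algebraMap C F c) = algebraMap C Q c :=
    fun c => IsFractionRing.lift_algebraMap hCQ c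
  have : IsScalarTower C F Q := .of_algebraMap_eq fun c => (hF c).symm
  have h2 : algebraMap F Q (algebraMap C F (algebraMap A C a) / algebraMap C F (algebraMap A C s))
      = algebraMap A Q a / algebraMap A Q s := by
    rw [map_div₀, hF, hF, ← IsScalarTower.algebraMap_apply, ← IsScalarTower.algebraMap_apply]
  rw [← h2, isIntegral_algebraMap_iff (algebraMap F Q).injective] at h1
  obtain ⟨c, hc⟩ := IsIntegrallyClosed.isIntegral_iff.1 h1
  refine ⟨algebraMap C D c, ?_⟩
  change algebraMap D Q (algebraMap C D c) = algebraMap R Q _ / algebraMap R Q _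
  rw [← IsScalarTower.algebraMap_apply, ← hF, hc, h2, ← IsScalarTower.algebraMap_apply,
    ← IsScalarTower.algebraMap_apply]

section Birational

variable {k A C L : Type*} [Field k] [CommRing A] [Algebra k A] [CommRing C] [Algebra k C]
  [Field L] [Algebra k L] (ρ : A →ₐ[k] C)

theorem injective_map_id_tensor (hρ : Function.Injective ρ) :
    Function.Injective (Algebra.TensorProduct.map (AlgHom.id L L) ρ) :=
  Module.Flat.lTensor_preserves_injective_linearMap (M := L) ρ.toLinearMap hρ

theorem exists_clear_denominators_tensor [IsDomain A]
    (hbir : ∀ c : C, ∃ a : A, a ≠ 0 ∧ ∃ a', ρ a' = ρ a * c) (z : L ⊗[k] C) :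
    ∃ a : A, a ≠ 0 ∧ ∃ w : L ⊗[k] A,
      Algebra.TensorProduct.map (AlgHom.id L L) ρ w = (1 ⊗ₜ ρ a) * z := by
  induction z with
  | zero => exact ⟨1, one_ne_zero, 0, by simp⟩
  | tmul l c =>
    obtain ⟨a, ha, a', h⟩ := hbir c
    exact ⟨a, ha, l ⊗ₜ a', by simp [h]⟩
  | add x y hx hy =>
    obtain ⟨a, ha, v, hv⟩ := hx
    obtain ⟨b, hb, w, hw⟩ := hy
    refine ⟨a * b, mul_ne_zero ha hb, (1 ⊗ₜ b) * v + (1 ⊗ₜ a) * w, ?_⟩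
    have h : (1 : L) ⊗ₜ[k] ρ (a * b) = (1 ⊗ₜ ρ a) * (1 ⊗ₜ ρ b) := by simp
    rw [h, map_add, map_mul, map_mul, hv, hw]
    simp only [Algebra.TensorProduct.map_tmul, map_one]
    ring

theorem isDomain_tensor_of_birational [IsDomain A] [IsDomain C] [IsDomain (L ⊗[k] A)]
    (hρ : Function.Injective ρ)
    (hbir : ∀ c : C, ∃ a : A, a ≠ 0 ∧ ∃ a', ρ a' = ρ a * c) : IsDomain (L ⊗[k] C) := by
  have hinj := injective_map_id_tensor (L := L) ρ hρ
  have hreg : ∀ a : A, a ≠ 0 → ∀ z : L ⊗[k] C, (1 ⊗ₜ ρ a) * z = 0 → z = 0 := by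
    intro a ha z hz
    have h : Function.Injective (LinearMap.lTensor L (LinearMap.mulLeft k (ρ a))) :=
      Module.Flat.lTensor_preserves_injective_linearMap _
        (mul_right_injective₀ ((map_ne_zero_iff ρ hρ).2 ha))
    refine h ?_
    rw [map_zero, ← hz]
    clear hz
    induction z with
    | zero => simp
    | tmul l c => simp
    | add x y hx hy => rw [map_add, hx, hy, mul_add]
  have : Nontrivial (L ⊗[k] C) := hinj.nontrivial
  have : NoZeroDivisors (L ⊗[k] C) := by
    refine ⟨fun {x y} hxy => ?_⟩
    obtain ⟨a, ha, v, hv⟩ := exists_clear_denominators_tensor ρ hbir x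
    obtain ⟨b, hb, w, hw⟩ := exists_clear_denominators_tensor ρ hbir y
    have : v * w = 0 := hinj (by
      rw [map_mul, hv, hw, map_zero, mul_mul_mul_comm, hxy, mul_zero])
    rcases mul_eq_zero.1 this with rfl | rfl
    · exact Or.inl (hreg a ha x (by rw [← hv, map_zero]))
    · exact Or.inr (hreg b hb y (by rw [← hw, map_zero]))
  exact NoZeroDivisors.to_isDomain _

end Birational

theorem isIntegrallyClosed_of_tensor (L L' : Type*) {D : Type*} [Field L] [Field L'] [Algebra L L']
    [CommRing D] [Algebra L D] [IsDomain D] [IsDomain (D ⊗[L] L')]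
    [IsIntegrallyClosed (D ⊗[L] L')] : IsIntegrallyClosed D := by
  have : Module.FaithfullyFlat D (D ⊗[L] L') := inferInstance
  refine IsIntegrallyClosed.of_dvd_reflecting (algebraMap D (D ⊗[L] L'))
    (FaithfulSMul.algebraMap_injective _ _) fun a b h => ?_
  rw [← Ideal.mem_span_singleton] at h ⊢
  rw [← Ideal.comap_map_eq_self_of_faithfullyFlat (B := D ⊗[L] L') (Ideal.span {b}),
    Ideal.mem_comap, Ideal.map_span, Set.image_singleton]
  exact h

/-- Integral closedness descends along extensions of the base field. -/
theorem isIntegrallyClosed_tensor_descent {k C L L' : Type*} [Field k] [CommRing C] [Algebra k C]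
    [Field L] [Algebra k L] [Field L'] [Algebra k L'] [Algebra L L'] [IsScalarTower k L L']
    [IsDomain (L ⊗[k] C)] [IsDomain (L' ⊗[k] C)] [IsIntegrallyClosed (L' ⊗[k] C)] :
    IsIntegrallyClosed (L ⊗[k] C) := by
  let e : L' ⊗[L] (L ⊗[k] C) ≃+* L' ⊗[k] C :=
    (Algebra.TensorProduct.cancelBaseChange k L L L' C).toRingEquiv
  let e' : (L ⊗[k] C) ⊗[L] L' ≃+* L' ⊗[k] C :=
    (Algebra.TensorProduct.comm L (L ⊗[k] C) L').toRingEquiv.trans e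
  have : IsDomain ((L ⊗[k] C) ⊗[L] L') := MulEquiv.isDomain _ e'.toMulEquiv
  have : IsIntegrallyClosed ((L ⊗[k] C) ⊗[L] L') := .of_equiv e'.symm
  exact isIntegrallyClosed_of_tensor L L'

theorem isIntegrallyClosed_tensor_of_perfect_intermediate {k P C L : Type*} [Field k] [CommRing C]
    [Algebra k C] [Field P] [PerfectField P] [Algebra k P] [Field L] [Algebra k L] [Algebra P L]
    [IsScalarTower k P L] [IsDomain (P ⊗[k] C)] [IsIntegrallyClosed (P ⊗[k] C)]
    [IsDomain (L ⊗[k] C)] : IsIntegrallyClosed (L ⊗[k] C) := by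
  let e : L ⊗[P] (P ⊗[k] C) ≃+* L ⊗[k] C :=
    (Algebra.TensorProduct.cancelBaseChange k P P L C).toRingEquiv
  have : IsDomain (L ⊗[P] (P ⊗[k] C)) := MulEquiv.isDomain _ e.toMulEquiv
  have := isIntegrallyClosed_tensor_of_perfectField (k := P) (L := L) (B := P ⊗[k] C)
  exact .of_equiv e

theorem isIntegrallyClosed_of_integralClosureGeneratedBy_of_ringHom {A R C D : Type u} [CommRing A]
    [CommRing R] [CommRing C] [CommRing D] [IsDomain C] [IsDomain D] [IsIntegrallyClosed C]
    (i : A →+* R) (g : A →+* C) (h : R →+* D) (j : C →+* D) (hcomm : h.comp i = j.comp g)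
    (hg : Function.Injective g) (hh : Function.Injective h) (hj : Function.Injective j)
    (hi : i.IsIntegral) (hh' : h.IsIntegral) {T : Set R} {s : A}
    (hs : s ≠ 0) (hT : T ⊆ Set.range i) (H : IntegralClosureGeneratedBy R T (i s))
    (hbir : ∀ d : D, ∃ r : R, r ≠ 0 ∧ ∃ r' : R, h r' = h r * d) : IsIntegrallyClosed D := by
  let := i.toAlgebra
  let := g.toAlgebra
  let := h.toAlgebra
  let := j.toAlgebra
  let := (h.comp i).toAlgebra
  have : IsScalarTower A R D := .of_algebraMap_eq fun _ => rfl
  have : IsScalarTower A C D := .of_algebraMap_eq fun x => congrArg (fun f => f x) hcomm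
  have : FaithfulSMul A C := (faithfulSMul_iff_algebraMap_injective A C).2 hg
  have : FaithfulSMul R D := (faithfulSMul_iff_algebraMap_injective R D).2 hh
  have : FaithfulSMul C D := (faithfulSMul_iff_algebraMap_injective C D).2 hj
  have : Algebra.IsIntegral A R := ⟨hi⟩
  have : Algebra.IsIntegral R D := ⟨hh'⟩
  exact isIntegrallyClosed_of_integralClosureGeneratedBy (C := C) hs hT H hbir

theorem isIntegral_map_id_tensor {k A C L : Type*} [CommRing k] [CommRing A] [Algebra k A]
    [CommRing C] [Algebra k C] [CommRing L] [Algebra k L] (ρ : A →ₐ[k] C)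
    (hρ : (ρ : A →+* C).IsIntegral) :
    (Algebra.TensorProduct.map (AlgHom.id L L) ρ : L ⊗[k] A →+* L ⊗[k] C).IsIntegral := by
  intro z
  induction z with
  | zero => exact RingHom.isIntegralElem_zero _
  | add x y hx hy => exact hx.add _ hy
  | tmul l c =>
    rw [← one_mul c, ← mul_one l, ← Algebra.TensorProduct.tmul_mul_tmul]
    refine RingHom.IsIntegralElem.mul _ ?_ ?_
    · have h : l ⊗ₜ[k] (1 : C) = Algebra.TensorProduct.map (AlgHom.id L L) ρ (l ⊗ₜ 1) := by simp
      rw [h]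
      exact RingHom.isIntegralElem_map _
    · obtain ⟨f, hf, hf0⟩ := hρ c
      refine ⟨f.map (Algebra.TensorProduct.includeRight : A →ₐ[k] L ⊗[k] A).toRingHom, hf.map _, ?_⟩
      rw [Polynomial.eval₂_map]
      have := congrArg (Algebra.TensorProduct.includeRight : C →ₐ[k] L ⊗[k] C).toRingHom hf0
      rw [Polynomial.hom_eval₂, map_zero] at this
      refine Eq.trans (congrArg (fun g => Polynomial.eval₂ g _ f) (RingHom.ext fun a => ?_)) this
      change Algebra.TensorProduct.map (AlgHom.id L L) ρ ((1 : L) ⊗ₜ a) = 1 ⊗ₜ ρ a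
      simp

theorem isIntegral_map_tensor_id {k A L L' : Type*} [CommRing k] [CommRing A] [Algebra k A]
    [CommRing L] [Algebra k L] [CommRing L'] [Algebra k L'] (j : L →ₐ[k] L')
    (hj : (j : L →+* L').IsIntegral) :
    (Algebra.TensorProduct.map j (AlgHom.id k A) : L ⊗[k] A →+* L' ⊗[k] A).IsIntegral := by
  intro z
  induction z with
  | zero => exact RingHom.isIntegralElem_zero _
  | add x y hx hy => exact hx.add _ hy
  | tmul l c =>
    rw [← one_mul c, ← mul_one l, ← Algebra.TensorProduct.tmul_mul_tmul]
    refine RingHom.IsIntegralElem.mul _ ?_ ?_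
    · obtain ⟨f, hf, hf0⟩ := hj l
      refine ⟨f.map (Algebra.TensorProduct.includeLeft : L →ₐ[k] L ⊗[k] A).toRingHom, hf.map _, ?_⟩
      rw [Polynomial.eval₂_map]
      have := congrArg (Algebra.TensorProduct.includeLeft : L' →ₐ[k] L' ⊗[k] A).toRingHom hf0
      rw [Polynomial.hom_eval₂, map_zero] at this
      refine Eq.trans (congrArg (fun g => Polynomial.eval₂ g _ f) (RingHom.ext fun a => ?_)) this
      change Algebra.TensorProduct.map j (AlgHom.id k A) (a ⊗ₜ 1) = j a ⊗ₜ 1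
      simp
    · have h : (1 : L') ⊗ₜ[k] c = Algebra.TensorProduct.map j (AlgHom.id k A) (1 ⊗ₜ c) := by simp
      rw [h]
      exact RingHom.isIntegralElem_map _

theorem isIntegrallyClosed_tensor_of_integralClosureGeneratedBy {K K' P A C : Type u} [Field K]
    [Field K'] [Field P] [Algebra K K'] [Algebra K P] [Algebra K' P] [IsScalarTower K K' P]
    [Algebra.IsIntegral K' P] [CommRing A] [Algebra K A] [IsDomain (K' ⊗[K] A)]
    [IsDomain (P ⊗[K] A)] [CommRing C] [IsDomain C] [IsIntegrallyClosed C] [Algebra K' C]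
    [IsDomain (P ⊗[K'] C)]
    (ρ : K' ⊗[K] A →ₐ[K'] C) (hρ : Function.Injective ρ) (hρ' : (ρ : K' ⊗[K] A →+* C).IsIntegral)
    (hbir : ∀ c, ∃ a, a ≠ 0 ∧ ∃ a', ρ a' = ρ a * c) {T : Set (P ⊗[K] A)} {s : P ⊗[K] A}
    (hs : s ≠ 0) (H : IntegralClosureGeneratedBy (P ⊗[K] A) T s)
    (hsT : ∀ x ∈ insert s T,
      x ∈ Set.range (Algebra.TensorProduct.map (IsScalarTower.toAlgHom K K' P) (AlgHom.id K A))) :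
    IsIntegrallyClosed (P ⊗[K'] C) := by
  obtain ⟨t, rfl⟩ := hsT s (Set.mem_insert _ _)
  let e := Algebra.TensorProduct.cancelBaseChange K K' P P A
  let m := Algebra.TensorProduct.map (AlgHom.id P P) ρ
  have hm : Function.Injective m := injective_map_id_tensor ρ hρ
  refine isIntegrallyClosed_of_integralClosureGeneratedBy_of_ringHom (T := T) (s := t)
    (Algebra.TensorProduct.map (IsScalarTower.toAlgHom K K' P) (AlgHom.id K A)).toRingHom
    ρ.toRingHom (m.toRingHom.comp e.symm.toAlgHom.toRingHom)
    (Algebra.TensorProduct.includeRight : C →ₐ[K'] P ⊗[K'] C).toRingHom ?_ hρ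
    ?_ ?_ ?_ ?_ (fun h => hs (by rw [h, map_zero]))
    (fun x hx => hsT x (Set.mem_insert_of_mem _ hx)) H ?_
  · refine RingHom.ext fun x => ?_
    change m (e.symm (Algebra.TensorProduct.map (IsScalarTower.toAlgHom K K' P)
      (AlgHom.id K A) x)) = 1 ⊗ₜ ρ x
    have : Algebra.TensorProduct.map (IsScalarTower.toAlgHom K K' P) (AlgHom.id K A) x =
        e (1 ⊗ₜ x) := by
      induction x with
      | zero => simp
      | add x y hx hy => rw [map_add, hx, hy, TensorProduct.tmul_add, map_add]
      | tmul l a => simp [e, Algebra.smul_def]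
    rw [this, e.symm_apply_apply]
    simp [m]
  · exact hm.comp e.symm.injective
  · exact Algebra.TensorProduct.includeRight_injective (algebraMap K' P).injective
  · exact isIntegral_map_tensor_id _ (algebraMap_isIntegral_iff.2 inferInstance)
  · exact RingHom.IsIntegral.trans _ _ (RingHom.isIntegral_of_surjective _ e.symm.surjective)
      (isIntegral_map_id_tensor ρ hρ')
  · intro d
    obtain ⟨a, ha, w, hw⟩ := exists_clear_denominators_tensor ρ hbir d
    refine ⟨e (1 ⊗ₜ a), ?_, e w, ?_⟩
    · have h1 : Function.Injective
          (Algebra.TensorProduct.includeRight : K' ⊗[K] A →ₐ[K'] P ⊗[K'] (K' ⊗[K] A)) :=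
        Algebra.TensorProduct.includeRight_injective (algebraMap K' P).injective
      intro h
      exact ha (h1 ((e.injective (h.trans (map_zero e).symm)).trans (map_zero _).symm))
    · change m (e.symm (e w)) = m (e.symm (e (1 ⊗ₜ a))) * d
      rw [e.symm_apply_apply, e.symm_apply_apply]
      simpa [m] using hw

theorem exists_forall_tensor_normal {K A : Type u} [Field K] (p : ℕ) [Fact p.Prime] [CharP K p]
    [CommRing A] [Algebra K A] [Algebra.FiniteType K A]
    (hdom : ∀ (L : Type u) [Field L] [Algebra K L], IsDomain (L ⊗[K] A)) :
    ∃ n₀ : ℕ, ∀ n ≥ n₀, ∀ (K' : Type u) [Field K'] [Algebra K K'] [IsPurelyInseparable K K'],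
      (∀ x : K, ∃ y : K', y ^ p ^ n = algebraMap K K' x) →
      ∀ (C : Type u) [CommRing C] [IsDomain C] [IsIntegrallyClosed C] [Algebra K' C]
        (ρ : K' ⊗[K] A →ₐ[K'] C), Function.Injective ρ → (ρ : K' ⊗[K] A →+* C).IsIntegral →
        (∀ c, ∃ a, a ≠ 0 ∧ ∃ a', ρ a' = ρ a * c) →
        ∀ (L : Type u) [Field L] [Algebra K' L],
          IsDomain (L ⊗[K'] C) ∧ IsIntegrallyClosed (L ⊗[K'] C) := by
  classical
  let P := perfectClosure K (AlgebraicClosure K)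
  have : CharP P p := charP_of_injective_algebraMap (algebraMap K P).injective p
  have : PerfectRing P p := inferInstance
  have : PerfectField P := PerfectRing.toPerfectField P p
  have := hdom P
  have : Module.Finite (P ⊗[K] A) (integralClosure (P ⊗[K] A) (FractionRing (P ⊗[K] A))) :=
    finite_integralClosure_of_perfectField P p
  obtain ⟨T, s, hs, H⟩ := exists_integralClosureGeneratedBy (P ⊗[K] A)
  obtain ⟨F, hF, hFT⟩ := exists_fg_intermediateField_mem_range (insert s T)
  have : IsPurelyInseparable K F := inferInstance
  have : FiniteDimensional K F := by
    have := IntermediateField.essFiniteType_iff.2 hF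
    exact .of_essFiniteType_of_isAlgebraic K F
  refine ⟨IsPurelyInseparable.exponent K F, fun n hn K' _ _ _ hK' C _ _ _ _ ρ hρ hρ' hbir => ?_⟩
  obtain ⟨j⟩ : Nonempty (K' →ₐ[K] P) := inferInstance
  have : CharP K' p := charP_of_injective_algebraMap (algebraMap K K').injective p
  let := j.toAlgebra
  have : IsScalarTower K K' P := .of_algebraMap_eq fun x => (j.commutes x).symm
  have hFj : ∀ x ∈ F, ∃ z, j z = x := by
    intro x hx
    obtain ⟨y, hy⟩ := IsPurelyInseparable.exponent_def' (K := K) p (⟨x, hx⟩ : F)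
    obtain ⟨z, hz⟩ := hK' (y ^ p ^ (n - IsPurelyInseparable.exponent K F))
    refine ⟨z, iterateFrobenius_inj P p n ?_⟩
    have hy' : algebraMap K P y = x ^ p ^ IsPurelyInseparable.exponent K F :=
      congrArg Subtype.val hy
    rw [iterateFrobenius_def, iterateFrobenius_def, ← map_pow, hz, j.commutes, map_pow, hy',
      ← pow_mul, ← pow_add, Nat.add_sub_cancel' hn]
  have : ∀ (L : Type u) [Field L] [Algebra K' L], IsDomain (L ⊗[K'] C) := by
    intro L _ _
    let := ((algebraMap K' L).comp (algebraMap K K')).toAlgebra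
    have : IsScalarTower K K' L := .of_algebraMap_eq fun _ => rfl
    have := hdom L
    have := hdom K'
    have : IsDomain (L ⊗[K'] (K' ⊗[K] A)) :=
      MulEquiv.isDomain _ (Algebra.TensorProduct.cancelBaseChange K K' L L A).toMulEquiv
    exact isDomain_tensor_of_birational ρ hρ hbir
  have := hdom K'
  have : Algebra.IsAlgebraic K' P := Algebra.IsAlgebraic.tower_top (K := K) K'
  have : IsIntegrallyClosed (P ⊗[K'] C) := by
    refine isIntegrallyClosed_tensor_of_integralClosureGeneratedBy ρ hρ hρ' hbir hs H
      fun x hx => ?_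
    obtain ⟨y, hy⟩ := hFT x (by simpa using hx)
    rw [← hy]
    clear hy
    induction y with
    | zero => exact ⟨0, by simp⟩
    | add u v hu hv =>
      obtain ⟨u', hu⟩ := hu
      obtain ⟨v', hv⟩ := hv
      exact ⟨u' + v', by rw [map_add, map_add, hu, hv]⟩
    | tmul l a =>
      obtain ⟨z, hz⟩ := hFj l.1 l.2
      refine ⟨z ⊗ₜ a, ?_⟩
      rw [Algebra.TensorProduct.map_tmul]
      exact congrArg (fun t => t ⊗ₜ[K] a) hz
  intro L _ _
  refine ⟨inferInstance, ?_⟩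
  have : IsPurelyInseparable K' P := IsPurelyInseparable.tower_top K K' P
  obtain ⟨φ⟩ : Nonempty (P →ₐ[K'] AlgebraicClosure L) := inferInstance
  let := φ.toAlgebra
  have : IsScalarTower K' P (AlgebraicClosure L) :=
    .of_algebraMap_eq fun x => (φ.commutes x).symm
  have : IsIntegrallyClosed (AlgebraicClosure L ⊗[K'] C) :=
    isIntegrallyClosed_tensor_of_perfect_intermediate (P := P)
  exact isIntegrallyClosed_tensor_descent (L' := AlgebraicClosure L)

theorem isIntegrallyClosed_stalk_iff_of_isOpenImmersion {X Y : Scheme.{u}} (f : X ⟶ Y)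
    [IsOpenImmersion f] (x : X) :
    IsIntegrallyClosed (Y.presheaf.stalk (f x)) ↔ IsIntegrallyClosed (X.presheaf.stalk x) :=
  let e := (asIso (f.stalkMap x)).commRingCatIsoToRingEquiv
  ⟨fun _ => .of_equiv e, fun _ => .of_equiv e.symm⟩

theorem isNormalScheme_Spec_iff {R : Type u} [CommRing R] :
    IsNormalScheme (Spec (CommRingCat.of R)) ↔ IsDomain R ∧ IsIntegrallyClosed R := by
  constructor
  · rintro ⟨h, hn⟩
    have : IsDomain R := (affine_isIntegral_iff _).1 h
    refine ⟨this, .of_localization_maximal fun m _ _ => ?_⟩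
    have := hn ⟨m, inferInstance⟩
    exact .of_equiv (Spec.stalkIso (CommRingCat.of R) ⟨m, inferInstance⟩).commRingCatIsoToRingEquiv
  · rintro ⟨_, _⟩
    refine ⟨inferInstance, fun x => ?_⟩
    have : x.asIdeal.IsPrime := x.2
    have : IsIntegrallyClosed (Localization.AtPrime x.asIdeal) :=
      isIntegrallyClosed_of_isLocalization _ x.asIdeal.primeCompl
        x.asIdeal.primeCompl_le_nonZeroDivisors
    exact .of_equiv (R := Localization.AtPrime x.asIdeal)
      (Spec.stalkIso (CommRingCat.of R) x).symm.commRingCatIsoToRingEquiv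

theorem _root_.IsNormalScheme.of_isOpenImmersion {X Y : Scheme.{u}} (f : X ⟶ Y) [IsOpenImmersion f]
    [Nonempty X] (hY : IsNormalScheme Y) : IsNormalScheme X :=
  have := hY.1
  ⟨isIntegral_of_isOpenImmersion f,
    fun x => (isIntegrallyClosed_stalk_iff_of_isOpenImmersion f x).1 (hY.2 _)⟩

theorem isNormalScheme_of_cover {X : Scheme.{u}} [Nonempty X] {ι : Type*} (U : ι → Scheme.{u})
    (m : ∀ i, U i ⟶ X) [∀ i, IsOpenImmersion (m i)] (hU : ∀ i, IsNormalScheme (U i))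
    (hcov : ∀ x, ∃ i, x ∈ Set.range (m i))
    (hmeet : ∀ i j, (Set.range (m i) ∩ Set.range (m j)).Nonempty) : IsNormalScheme X := by
  have hstalk : ∀ x : X, IsIntegrallyClosed (X.presheaf.stalk x) := by
    intro x
    obtain ⟨i, y, rfl⟩ := hcov x
    exact (isIntegrallyClosed_stalk_iff_of_isOpenImmersion _ y).2 ((hU i).2 y)
  have hred : ∀ x : X, _root_.IsReduced (X.presheaf.stalk x) := by
    intro x
    obtain ⟨i, y, rfl⟩ := hcov x
    have := (hU i).1
    exact isReduced_of_injective _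
      (asIso ((m i).stalkMap y)).commRingCatIsoToRingEquiv.injective
  have : PreirreducibleSpace X := by
    refine PreirreducibleSpace.of_isOpenCover (U := fun i => (m i).opensRange) ?_ ?_ ?_
    · intro i j _ h
      obtain ⟨x, hx⟩ := hmeet i j
      have := (disjoint_iff.1 h).le (show x ∈ (m i).opensRange ⊓ (m j).opensRange from hx)
      exact this
    · refine TopologicalSpace.Opens.ext (Set.eq_univ_of_forall fun x => ?_)
      simpa using hcov x
    · intro i
      have := (hU i).1
      have h : IsPreirreducible (Set.range (m i)) := by
        rw [← Set.image_univ]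
        exact PreirreducibleSpace.isPreirreducible_univ.image _ (m i).continuous.continuousOn
      exact Subtype.preirreducibleSpace h
  have : IrreducibleSpace X := ⟨inferInstance⟩
  have := isReduced_of_isReduced_stalk X
  exact ⟨isIntegral_of_irreducibleSpace_of_isReduced X, hstalk⟩

theorem exists_isOpenImmersion_tensor {k L C : Type u} [Field k] [Field L] [Algebra k L]
    [CommRing C] [Algebra k C] {Y : Scheme.{u}} (g : Y ⟶ SpecOf k)
    (m : Spec (CommRingCat.of C) ⟶ Y) [IsOpenImmersion m] (hm : m ≫ g = specMapAlg k C) :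
    ∃ m' : Spec (CommRingCat.of (L ⊗[k] C)) ⟶ pullback g (specMapAlg k L), IsOpenImmersion m' ∧
      Set.range m' = pullback.fst g (specMapAlg k L) ⁻¹' Set.range m ∧
      m' ≫ pullback.snd g (specMapAlg k L) = Spec.map (CommRingCat.ofHom
        (algebraMap L (L ⊗[k] C))) ∧
      m' ≫ pullback.fst g (specMapAlg k L) = Spec.map (CommRingCat.ofHom
        (Algebra.TensorProduct.includeRight : C →ₐ[k] L ⊗[k] C).toRingHom) ≫ m := by
  have hp := isPullback_SpecMap_of_isPushout _ _ _ _ (CommRingCat.isPushout_tensorProduct k L C)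
  have hp' := IsPullback.of_hasPullback g (specMapAlg k L)
  let a : Spec (CommRingCat.of (L ⊗[k] C)) ⟶ SpecOf L :=
    Spec.map (CommRingCat.ofHom (algebraMap L (L ⊗[k] C)))
  let b : Spec (CommRingCat.of (L ⊗[k] C)) ⟶ Spec (CommRingCat.of C) := Spec.map
    (CommRingCat.ofHom (Algebra.TensorProduct.includeRight : C →ₐ[k] L ⊗[k] C).toRingHom)
  have hab : IsPullback a b (specMapAlg k L) (m ≫ g) := hm ▸ hp
  let m' : Spec (CommRingCat.of (L ⊗[k] C)) ⟶ pullback g (specMapAlg k L) :=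
    pullback.lift (b ≫ m) a (by rw [Category.assoc, hab.w])
  have h1 : m' ≫ pullback.fst g (specMapAlg k L) = b ≫ m := pullback.lift_fst _ _ _
  have h2 : m' ≫ pullback.snd g (specMapAlg k L) = a := pullback.lift_snd _ _ _
  have hq : IsPullback b m' m (pullback.fst g (specMapAlg k L)) :=
    IsPullback.of_bot (by rw [h2]; exact hab.flip) h1.symm hp'
  refine ⟨m', MorphismProperty.of_isPullback (P := @IsOpenImmersion) hq inferInstance, ?_, h2, h1⟩
  have := Scheme.image_preimage_eq_of_isPullback hq Set.univ
  simpa using this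

theorem isDominant_Spec_map_fractionRing {R Q : Type u} [CommRing R] [IsDomain R] [Field Q]
    [Algebra R Q] [IsFractionRing R Q] {X : Scheme.{u}} [IsIntegral X]
    (m : Spec (CommRingCat.of R) ⟶ X) [IsOpenImmersion m] :
    IsDominant (Spec.map (CommRingCat.ofHom (algebraMap R Q)) ≫ m) := by
  have : IsDominant (Spec.map (CommRingCat.ofHom (algebraMap R Q))) :=
    ⟨(PrimeSpectrum.denseRange_comap_iff_ker_le_nilRadical _).2 (by
      simp [(RingHom.injective_iff_ker_eq_bot _).1 (IsFractionRing.injective R Q)])⟩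
  have : IsDominant m := ⟨m.isOpenEmbedding.isOpen_range.dense (Set.range_nonempty _)⟩
  infer_instance

theorem exists_chart_of_isNormalization {X Y : Scheme.{u}} [IsIntegral X] (ν : Y ⟶ X)
    (hν : IsNormalization ν) {R : Type u} [CommRing R] [IsDomain R]
    (m : Spec (CommRingCat.of R) ⟶ X) [IsOpenImmersion m] :
    ∃ (C : Type u) (_ : CommRing C) (_ : IsDomain C) (_ : IsIntegrallyClosed C) (φ : R →+* C)
      (m' : Spec (CommRingCat.of C) ⟶ Y), IsOpenImmersion m' ∧
      Set.range m' = ν ⁻¹' Set.range m ∧ m' ≫ ν = Spec.map (CommRingCat.ofHom φ) ≫ m ∧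
      Function.Injective φ ∧ φ.IsIntegral ∧ ∀ c, ∃ a, a ≠ 0 ∧ ∃ a', φ a' = φ a * c := by
  obtain ⟨hY, _, _, huniv⟩ := hν
  let W := pullback ν m
  have : IsAffine W := isAffine_of_isAffineHom (pullback.snd ν m)
  let C := Γ(W, ⊤)
  let Q := FractionRing R
  let e : Spec C ⟶ W := W.isoSpec.inv
  obtain ⟨φ, hφ⟩ : ∃ φ : CommRingCat.of R ⟶ C, Spec.map φ = e ≫ pullback.snd ν m :=
    Spec.map_surjective _
  obtain ⟨h, hh, -⟩ := huniv (Spec (CommRingCat.of Q))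
    (Spec.map (CommRingCat.ofHom (algebraMap R Q)) ≫ m)
    (isNormalScheme_Spec_iff.2 ⟨inferInstance, inferInstance⟩) (isDominant_Spec_map_fractionRing m)
  let l : Spec (CommRingCat.of Q) ⟶ W := pullback.lift h _ hh
  obtain ⟨ψ, hψ⟩ : ∃ ψ : C ⟶ CommRingCat.of Q, Spec.map ψ = l ≫ W.isoSpec.hom :=
    Spec.map_surjective _
  have hcomp : φ ≫ ψ = CommRingCat.ofHom (algebraMap R Q) := by
    apply Spec.map_injective
    rw [Spec.map_comp, hφ, hψ]
    have hl : l ≫ pullback.snd ν m = Spec.map (CommRingCat.ofHom (algebraMap R Q)) :=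
      pullback.lift_snd _ _ _
    rw [Category.assoc, Iso.hom_inv_id_assoc, hl]
  have hcomp' : ∀ r, ψ.hom (φ.hom r) = algebraMap R Q r := fun r =>
    congrArg (fun g => g.hom r) hcomp
  have : Nonempty (Spec C) := ⟨Spec.map ψ (Classical.arbitrary _)⟩
  have hC : IsNormalScheme (Spec C) := hY.of_isOpenImmersion (e ≫ pullback.fst ν m)
  obtain ⟨_, _⟩ := isNormalScheme_Spec_iff.1 hC
  have hφi : φ.hom.IsIntegral := by
    rw [← IsIntegralHom.SpecMap_iff, hφ]
    infer_instance
  have hφinj : Function.Injective φ.hom := fun a b hab =>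
    IsFractionRing.injective R Q (by rw [← hcomp', ← hcomp', hab])
  have hψinj : Function.Injective ψ.hom := by
    let := φ.hom.toAlgebra
    have : Algebra.IsIntegral R C := ⟨hφi⟩
    rw [RingHom.injective_iff_ker_eq_bot]
    refine Ideal.eq_bot_of_comap_eq_bot (R := R) (eq_bot_iff.2 fun r hr => ?_)
    refine IsFractionRing.injective R Q ?_
    rw [map_zero, ← hcomp']
    exact hr
  refine ⟨C, inferInstance, inferInstance, inferInstance, φ.hom, e ≫ pullback.fst ν m,
    inferInstance, ?_, ?_, hφinj, hφi, fun c => ?_⟩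
  · rw [← Scheme.Pullback.range_fst, Scheme.Hom.comp_base, TopCat.coe_comp, Set.range_comp,
      Set.range_eq_univ.2 e.surjective, Set.image_univ]
  · rw [Category.assoc, pullback.condition, ← Category.assoc, ← hφ]
    rfl
  · obtain ⟨a, b, hb, hab⟩ := IsFractionRing.div_surjective (A := R) (ψ.hom c)
    refine ⟨b, nonZeroDivisors.ne_zero hb, a, hψinj ?_⟩
    rw [map_mul, hcomp', hcomp', ← hab, mul_div_cancel₀]
    exact (map_ne_zero_iff _ (IsFractionRing.injective R Q)).2 (nonZeroDivisors.ne_zero hb)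

theorem isDomain_tensor_of_isGeometricallyIntegral {K A : Type u} [Field K] [CommRing A]
    [Nontrivial A] [Algebra K A] {X : Scheme.{u}} (f : X ⟶ SpecOf K)
    (hX : IsGeometricallyIntegral f) (m : Spec (CommRingCat.of A) ⟶ X) [IsOpenImmersion m]
    (hm : m ≫ f = specMapAlg K A) (L : Type u) [Field L] [Algebra K L] :
    IsDomain (L ⊗[K] A) := by
  obtain ⟨m', _, -⟩ := exists_isOpenImmersion_tensor (L := L) f m hm
  have : IsIntegral (pullback f (specMapAlg K L)) := hX L
  exact (affine_isIntegral_iff (CommRingCat.of (L ⊗[K] A))).1 (isIntegral_of_isOpenImmersion m')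

/-- A bound `n₀` beyond which purely inseparable extensions containing all `p ^ n`-th roots make the
normalization geometrically normal over a given affine chart. -/
theorem exists_forall_chart_normal {K A : Type u} [Field K] (p : ℕ) [Fact p.Prime] [CharP K p]
    [CommRing A] [Nontrivial A] [Algebra K A] {X : Scheme.{u}} (f : X ⟶ SpecOf K)
    [LocallyOfFiniteType f] (hX : IsGeometricallyIntegral f) (m : Spec (CommRingCat.of A) ⟶ X)
    [IsOpenImmersion m] (hm : m ≫ f = specMapAlg K A) :
    ∃ n₀ : ℕ, ∀ n ≥ n₀, ∀ (K' : Type u) [Field K'] [Algebra K K'] [IsPurelyInseparable K K'],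
      (∀ x : K, ∃ y : K', y ^ p ^ n = algebraMap K K' x) →
      ∀ (Y : Scheme.{u}) (ν : Y ⟶ pullback f (specMapAlg K K')), IsNormalization ν →
        ∀ (L : Type u) [Field L] [Algebra K' L],
          ∃ (U : Scheme.{u})
            (j : U ⟶ pullback (ν ≫ pullback.snd f (specMapAlg K K')) (specMapAlg K' L)),
            IsOpenImmersion j ∧ IsNormalScheme U ∧
            Set.range j = pullback.fst (ν ≫ pullback.snd f (specMapAlg K K')) (specMapAlg K' L) ⁻¹'
              (ν ⁻¹' (pullback.fst f (specMapAlg K K') ⁻¹' Set.range m)) := by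
  have : Algebra.FiniteType K A := by
    have : LocallyOfFiniteType (specMapAlg K A) := hm ▸ inferInstance
    exact RingHom.finiteType_algebraMap.1 (HasRingHomProperty.Spec_iff.1 this)
  have hdom := fun (L : Type u) [Field L] [Algebra K L] =>
    isDomain_tensor_of_isGeometricallyIntegral f hX m hm L
  obtain ⟨n₀, H⟩ := exists_forall_tensor_normal p hdom
  refine ⟨n₀, fun n hn K' _ _ _ hK' Y ν hν L _ _ => ?_⟩
  have := hdom K'
  have : IsIntegral (pullback f (specMapAlg K K')) := hX K'
  obtain ⟨m₁, _, hr₁, hs₁, -⟩ := exists_isOpenImmersion_tensor (L := K') f m hm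
  obtain ⟨C, _, _, _, φ, m₂, _, hr₂, hm₂, hinj, hint, hbir⟩ :=
    exists_chart_of_isNormalization ν hν m₁
  let := (φ.comp (algebraMap K' (K' ⊗[K] A))).toAlgebra
  let ρ : K' ⊗[K] A →ₐ[K'] C := { φ with commutes' := fun _ => rfl }
  obtain ⟨_, _⟩ := H n hn K' hK' C ρ hinj hint hbir L
  have hstr : m₂ ≫ ν ≫ pullback.snd f (specMapAlg K K') = specMapAlg K' C := by
    rw [← Category.assoc, hm₂, Category.assoc, hs₁, ← Spec.map_comp]
    rfl
  obtain ⟨m₃, h₃, hr₃, -⟩ := exists_isOpenImmersion_tensor (L := L) _ m₂ hstr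
  exact ⟨_, m₃, h₃, isNormalScheme_Spec_iff.2 ⟨inferInstance, inferInstance⟩, by
    rw [hr₃, hr₂, hr₁]⟩

theorem exists_nontrivial_chart {K : Type u} [Field K] {X : Scheme.{u}} (f : X ⟶ SpecOf K) (x : X) :
    ∃ (A : Type u) (_ : CommRing A) (_ : Nontrivial A) (_ : Algebra K A)
      (m : Spec (CommRingCat.of A) ⟶ X), IsOpenImmersion m ∧ m ≫ f = specMapAlg K A ∧
      x ∈ Set.range m := by
  obtain ⟨R, m, _, hx, -⟩ := Scheme.exists_affine_mem_range_and_range_subset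
    (U := (⊤ : X.Opens)) (x := x) trivial
  obtain ⟨φ, hφ⟩ := Spec.map_surjective (m ≫ f)
  have : Nontrivial R := by
    obtain ⟨y, -⟩ := hx
    exact PrimeSpectrum.nonempty_iff_nontrivial.1 ⟨y⟩
  exact ⟨R, inferInstance, inferInstance, φ.hom.toAlgebra, m, inferInstance, hφ.symm, hx⟩

theorem exists_forall_isGeometricallyNormal {K : Type u} [Field K] (p : ℕ) [Fact p.Prime]
    [CharP K p] {X : Scheme.{u}} (f : X ⟶ SpecOf K) [LocallyOfFiniteType f] [QuasiCompact f]
    (hX : IsGeometricallyIntegral f) :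
    ∃ n₀ : ℕ, ∀ n ≥ n₀, ∀ (K' : Type u) [Field K'] [Algebra K K'] [IsPurelyInseparable K K'],
      (∀ x : K, ∃ y : K', y ^ p ^ n = algebraMap K K' x) →
      ∀ (Y : Scheme.{u}) (ν : Y ⟶ pullback f (specMapAlg K K')), IsNormalization ν →
        IsGeometricallyNormal (ν ≫ pullback.snd f (specMapAlg K K')) := by
  have : CompactSpace X := QuasiCompact.compactSpace_of_compactSpace f
  choose A _ _ _ m hm hmf hmx using exists_nontrivial_chart f
  choose n₀ H using fun x => exists_forall_chart_normal p f hX (m x) (hmf x)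
  obtain ⟨t, ht⟩ := isCompact_univ.elim_finite_subcover (fun x => Set.range (m x))
    (fun x => (m x).isOpenEmbedding.isOpen_range) fun x _ => Set.mem_iUnion.2 ⟨x, hmx x⟩
  refine ⟨t.sup n₀, fun n hn K' _ _ _ hK' Y ν hν L _ _ => ?_⟩
  have hn' : ∀ x : t, n₀ x ≤ n := fun x => (Finset.le_sup x.2).trans hn
  choose U j hj hU hr using fun x : t => H x n (hn' x) K' hK' Y ν hν L
  let g := ν ≫ pullback.snd f (specMapAlg K K')
  have hsurj : ∀ (k k' : Type u) [Field k] [Field k'] [Algebra k k'],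
      Surjective (specMapAlg k k') := fun k k' _ _ _ =>
    ⟨fun x => ⟨Classical.arbitrary (PrimeSpectrum k'), Subsingleton.elim (α := PrimeSpectrum k) _ _⟩⟩
  have := hsurj K K'
  have := hsurj K' L
  have := hν.1.1
  have : IsIntegral (pullback f (specMapAlg K K')) := hX K'
  have hg : Function.Surjective (pullback.fst g (specMapAlg K' L)) := Scheme.Hom.surjective _
  have hf : Function.Surjective (pullback.fst f (specMapAlg K K')) := Scheme.Hom.surjective _
  have : Nonempty ↥(pullback g (specMapAlg K' L)) := hg.nonempty
  refine isNormalScheme_of_cover (X := pullback g (specMapAlg K' L)) U j hU (fun x => ?_)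
    fun a b => ?_
  · obtain ⟨y, hy, hxy⟩ := Set.mem_iUnion₂.1 (ht (Set.mem_univ
      (pullback.fst f (specMapAlg K K') (ν (pullback.fst g (specMapAlg K' L) x)))))
    refine ⟨⟨y, hy⟩, ?_⟩
    rw [hr]
    exact hxy
  · have hopen : ∀ x, IsOpen (pullback.fst f (specMapAlg K K') ⁻¹' Set.range (m x)) := fun x =>
      (m x).isOpenEmbedding.isOpen_range.preimage (Scheme.Hom.continuous _)
    have hne : ∀ x, (pullback.fst f (specMapAlg K K') ⁻¹' Set.range (m x)).Nonempty := fun x =>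
      Set.Nonempty.preimage ⟨x, hmx x⟩ hf
    obtain ⟨y, hy⟩ := hν.2.2.1.denseRange.exists_mem_open ((hopen a).inter (hopen b))
      (nonempty_preirreducible_inter (hopen a) (hopen b) (hne a) (hne b))
    obtain ⟨z, rfl⟩ := hg y
    refine ⟨z, ?_⟩
    rw [hr, hr]
    exact hy

theorem exists_forall_iterFrobPullback {K : Type u} [Field K] (p : ℕ) [Fact p.Prime]
    [CharP K p] {X : Scheme.{u}} (f : X ⟶ SpecOf K) [LocallyOfFiniteType f] [QuasiCompact f]
    (hX : IsGeometricallyIntegral f) :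
    ∃ n₀ : ℕ, ∀ n ≥ n₀, ∀ (Y : Scheme.{u}) (ν : Y ⟶ iterFrobPullback f p n),
      IsNormalization ν →
        IsGeometricallyNormal (ν ≫ pullback.snd f (iterFrobSpec K p n)) := by
  obtain ⟨n₀, H⟩ := exists_forall_isGeometricallyNormal p f hX
  refine ⟨n₀, fun n hn Y ν hν => ?_⟩
  let algF : Algebra K K := (iterateFrobenius K p n).toAlgebra
  have : @IsPurelyInseparable K K _ _ algF := by
    rw [@isPurelyInseparable_iff_pow_mem K K _ _ _ algF p _]
    exact fun x => ⟨n, x, (iterateFrobenius_def p n x)⟩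
  exact @H n hn K _ algF this (fun x => ⟨x, (iterateFrobenius_def p n x).symm⟩) Y ν hν

end GeometricNormality

/-- for all large `n` the normalization of the iterated Frobenius
pullback `X^{(pⁿ)}` is geometrically normal. -/
theorem stmt_1 {K : Type u} [Field K] (p : ℕ) [Fact p.Prime] [CharP K p]
    {X : Scheme.{u}} (f : X ⟶ SpecOf K) [LocallyOfFiniteType f] [QuasiCompact f]
    (hXnormal : IsNormalScheme X) (hXgi : IsGeometricallyIntegral f) :
    ∃ n₀ : ℕ, ∀ n ≥ n₀, ∀ (Y : Scheme.{u}) (ν : Y ⟶ iterFrobPullback f p n),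
      IsNormalization ν →
        IsGeometricallyNormal (ν ≫ pullback.snd f (iterFrobSpec K p n)) :=
  GeometricNormality.exists_forall_iterFrobPullback p f hXgi
end
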